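/- There exists a universal constant C > 0 with the following property. Consider the two-layer neural network f_NN(x) = Σ_{j=1}^m w_j σ(θ_jᵀ x) with fixed weights |w_j| ≤ 1, parameters θ = (θ_1, …, θ_m) ∈ (ℝ^{d'})^m, and data points (x_i, y_i), i = 1, …, n, with ‖x_i‖ = 1 and |y_i| ≤ m c, and the squared loss 𝓛(θ) = Σ_{i=1}^n (y_i − f_NN(x_i))². Suppose the activation σ : ℝ → ℝ is three times differentiable with |σ(z)|, |σ'(z)|, |σ''(z)|, |σ'''(z)| ≤ c for all z ∈ ℝ, and that ‖Σ_{i=1}^n x_i x_iᵀ‖₂ ≤ β. Then for every θ: ‖∇²𝓛_θ‖₂ ≤ C m n c², ‖∇³𝓛_θ‖_{{1,2,3}} ≤ C m^{3/2} n c², and ‖∇³𝓛_θ‖_{{1,2}{3}} ≤ C ( m n^{1/2} (1 + β^{1/2}) + n m^{1/2} ) c². -/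

import Mathlib

open MeasureTheory Real
open scoped ENNReal NNReal

noncomputable section

/-- The Euclidean space `ℝ^d`. -/
abbrev Euc (d : ℕ) := EuclideanSpace ℝ (Fin d)

/-- `leapfrog f η k (q₀,p₀)` is the `k`-th leapfrog iterate with step size `η` for the
potential `f`, starting at `(q₀,p₀)`. -/
def leapfrog {d : ℕ} (f : Euc d → ℝ) (η : ℝ) : ℕ → Euc d × Euc d → Euc d × Euc d
  | 0, z => z
  | (k+1), z =>
      let w := leapfrog f η k z
      let q' := w.1 + η • w.2 - (η^2/2) • gradient f w.1
      (q', w.2 - (η/2) • gradient f w.1 - (η/2) • gradient f q')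

/-- `f` is `L`-smooth: the Hessian has operator norm at most `L` everywhere. -/
def LSmooth {d : ℕ} (f : Euc d → ℝ) (L : ℝ) : Prop :=
  ∀ x, ‖fderiv ℝ (gradient f) x‖ ≤ L

/-- The entries of the third-derivative tensor of `f` at `x`. -/
def tensor3 {ι : Type*} [Fintype ι] [DecidableEq ι]
    (f : EuclideanSpace ℝ ι → ℝ) (x : EuclideanSpace ℝ ι) (i j k : ι) : ℝ :=
  iteratedFDeriv ℝ 3 f x
    ![EuclideanSpace.single i 1, EuclideanSpace.single j 1, EuclideanSpace.single k 1]

/-- The `{1,2,3}`-norm (Frobenius norm) of a 3-tensor. -/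
def norm123 {ι : Type*} [Fintype ι] (A : ι → ι → ι → ℝ) : ℝ :=
  Real.sqrt (∑ i, ∑ j, ∑ k, (A i j k)^2)

/-- The `{1,2}{3}`-norm of a 3-tensor. -/
def norm12_3 {ι : Type*} [Fintype ι] (A : ι → ι → ι → ℝ) : ℝ :=
  sSup { s | ∃ (X : ι → ι → ℝ) (y : ι → ℝ), (∑ i, ∑ j, (X i j)^2) ≤ 1 ∧
    (∑ k, (y k)^2) ≤ 1 ∧ s = ∑ i, ∑ j, ∑ k, A i j k * X i j * y k }

/-- `f` is `γ L^{3/2}`-strongly Hessian Lipschitz. -/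
def StronglyHessLip {d : ℕ} (f : Euc d → ℝ) (γ L : ℝ) : Prop :=
  ∀ x, norm12_3 (tensor3 f x) ≤ γ * L ^ ((3:ℝ)/2)

/-- Distance between two sets. -/
def setDistance {α : Type*} [PseudoMetricSpace α] (S T : Set α) : ℝ :=
  sInf { r | ∃ x ∈ S, ∃ y ∈ T, r = dist x y }

/-- Cheeger isoperimetric inequality with coefficient `ψ`. -/
def CheegerIso {d : ℕ} (μ : Measure (Euc d)) (ψ : ℝ) : Prop :=
  ∀ S1 S2 S3 : Set (Euc d), MeasurableSet S1 → MeasurableSet S2 → MeasurableSet S3 →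
    Disjoint S1 S2 → Disjoint S1 S3 → Disjoint S2 S3 → S1 ∪ S2 ∪ S3 = Set.univ →
    ψ * setDistance S1 S2 * (μ S1).toReal * (μ S2).toReal ≤ (μ S3).toReal

/-- The probability measure proportional to `e^{-f}`. -/
def targetMeasure {d : ℕ} (f : Euc d → ℝ) : Measure (Euc d) :=
  ((volume.withDensity fun x => ENNReal.ofReal (Real.exp (-f x))) Set.univ)⁻¹ •
    (volume.withDensity fun x => ENNReal.ofReal (Real.exp (-f x)))

/-- The standard Gaussian measure `N(0, I_d)` on `ℝ^d`. -/
def stdGaussian (d : ℕ) : Measure (Euc d) :=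
  Measure.map (⇑(EuclideanSpace.equiv (Fin d) ℝ).symm)
    (Measure.pi fun _ : Fin d => ProbabilityTheory.gaussianReal 0 1)

/-- Metropolis acceptance probability of the HMC proposal. -/
def accProb {d : ℕ} (f : Euc d → ℝ) (K : ℕ) (η : ℝ) (q p : Euc d) : ℝ :=
  min 1 (Real.exp (-(f (leapfrog f η K (q,p)).1) - ‖(leapfrog f η K (q,p)).2‖^2/2
    + f q + ‖p‖^2/2))

/-- One step of Metropolized HMC with `K` leapfrog steps and step size `η`, from `q`. -/
def hmcKernel {d : ℕ} (f : Euc d → ℝ) (K : ℕ) (η : ℝ) (q : Euc d) : Measure (Euc d) :=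
  (stdGaussian d).bind fun p =>
    ENNReal.ofReal (accProb f K η q p) • Measure.dirac (leapfrog f η K (q,p)).1 +
    ENNReal.ofReal (1 - accProb f K η q p) • Measure.dirac q

/-- One step of the lazy version of Metropolized HMC. -/
def lazyHMC {d : ℕ} (f : Euc d → ℝ) (K : ℕ) (η : ℝ) (q : Euc d) : Measure (Euc d) :=
  (2:ℝ≥0∞)⁻¹ • Measure.dirac q + (2:ℝ≥0∞)⁻¹ • hmcKernel f K η q

/-- The law of the lazy Metropolized HMC chain after `n` steps started from `μ₀`. -/
def hmcIter {d : ℕ} (f : Euc d → ℝ) (K : ℕ) (η : ℝ) (μ0 : Measure (Euc d)) :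
    ℕ → Measure (Euc d)
  | 0 => μ0
  | (n+1) => (hmcIter f K η μ0 n).bind (lazyHMC f K η)

/-- Total variation distance between two measures. -/
def tvDist {α : Type*} [MeasurableSpace α] (P Q : Measure α) : ℝ :=
  sSup { r | ∃ A, MeasurableSet A ∧ r = |(P A).toReal - (Q A).toReal| }

/-- `ε`-mixing time of lazy Metropolized HMC started from `μ₀`, targetting `μ ∝ e^{-f}`. -/
def mixingTime {d : ℕ} (f : Euc d → ℝ) (K : ℕ) (η : ℝ) (μ0 : Measure (Euc d)) (ε : ℝ) : ℕ :=
  sInf { n : ℕ | tvDist (hmcIter f K η μ0 n) (targetMeasure f) ≤ ε }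

/-- `μ₀` is `M`-warm with respect to `μ`. -/
def Warm {α : Type*} [MeasurableSpace α] (μ0 μ : Measure α) (M : ℝ) : Prop :=
  ∀ S : Set α, MeasurableSet S → μ0 S ≤ ENNReal.ofReal M * μ S

/-- `e^{-f}` has subexponential tail. -/
def SubexpTail {d : ℕ} (f : Euc d → ℝ) : Prop :=
  ∃ lam > (0:ℝ), Filter.Tendsto (fun x : Euc d => Real.exp (lam * ‖x‖) * Real.exp (-f x))
    (Bornology.cobounded _) (nhds 0)

end

/-- Cauchy–Schwarz against a vector with entries bounded by `c`. -/
lemma abs_sum_le_mul_sqrt_card_mul_sqrt {ι : Type*} [Fintype ι] (s M : ι → ℝ) {c : ℝ}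
    (hs : ∀ j, |s j| ≤ c) :
    |∑ j, s j * M j| ≤ c * (√(Fintype.card ι) * √(∑ j, M j ^ 2)) := by
  by_cases hι : Nonempty ι
  swap
  · simp [not_nonempty_iff.mp hι]
  have hc : 0 ≤ c := (abs_nonneg _).trans (hs hι.some)
  have h1 : (∑ j, s j * M j) ^ 2 ≤ (∑ j, s j ^ 2) * ∑ j, M j ^ 2 :=
    Finset.sum_mul_sq_le_sq_mul_sq _ _ _
  have h2 : ∑ j, s j ^ 2 ≤ Fintype.card ι * c ^ 2 := by
    have : ∀ j ∈ Finset.univ, s j ^ 2 ≤ c ^ 2 := fun j _ => sq_le_sq' (abs_le.mp (hs j)).1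
      (abs_le.mp (hs j)).2
    simpa using Finset.sum_le_card_nsmul _ _ _ this
  have h0 : 0 ≤ ∑ j, M j ^ 2 := Finset.sum_nonneg fun _ _ => sq_nonneg _
  apply abs_le_of_sq_le_sq _ (by positivity)
  rw [mul_pow, mul_pow, Real.sq_sqrt (by positivity), Real.sq_sqrt h0]
  nlinarith

/-- Applying a contraction along each of the three axes of a tensor does not increase its
Frobenius norm. -/
lemma sum_contract_sq_le {ι κ : Type*} [Fintype ι] [Fintype κ] (L : κ → ι → ℝ)
    (hL : ∀ v : ι → ℝ, ∑ j, (∑ p, L j p * v p) ^ 2 ≤ ∑ p, v p ^ 2) (W : ι → ι → ι → ℝ) :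
    ∑ j, ∑ l, ∑ h, (∑ p, L j p * ∑ q, L l q * ∑ r, L h r * W p q r) ^ 2
      ≤ ∑ p, ∑ q, ∑ r, W p q r ^ 2 := by
  calc _ = ∑ l, ∑ h, ∑ j, (∑ p, L j p * ∑ q, L l q * ∑ r, L h r * W p q r) ^ 2 := by
        rw [Finset.sum_comm]
        exact Finset.sum_congr rfl fun _ _ => Finset.sum_comm
    _ ≤ ∑ l, ∑ h, ∑ p, (∑ q, L l q * ∑ r, L h r * W p q r) ^ 2 := by
        gcongr with l _ h _
        exact hL _
    _ = ∑ p, ∑ h, ∑ l, (∑ q, L l q * ∑ r, L h r * W p q r) ^ 2 := by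
        rw [Finset.sum_comm, Finset.sum_congr rfl fun _ _ => Finset.sum_comm, Finset.sum_comm]
    _ ≤ ∑ p, ∑ h, ∑ q, (∑ r, L h r * W p q r) ^ 2 := by
        gcongr with p _ h _
        exact hL _
    _ = ∑ p, ∑ q, ∑ h, (∑ r, L h r * W p q r) ^ 2 :=
        Finset.sum_congr rfl fun _ _ => Finset.sum_comm
    _ ≤ _ := by
        gcongr with p _ q _
        exact hL _

/-- One sample's contribution to the third derivative of a squared loss, paired with a tensor `W`
whose compression to the hidden units is `M`. -/
lemma abs_third_deriv_pairing_le {m : ℕ} (M : Fin m → Fin m → Fin m → ℝ)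
    (s1 s2 s3 : Fin m → ℝ) {r c N : ℝ} (hc : 0 ≤ c)
    (h1 : ∀ j, |s1 j| ≤ c) (h2 : ∀ j, |s2 j| ≤ c) (h3 : ∀ j, |s3 j| ≤ c)
    (hr : |r| ≤ 2 * m * c) (hN : √(∑ j, ∑ l, ∑ h, M j l h ^ 2) ≤ N) :
    |∑ j, ∑ l, 2 * (s2 j * s1 l) * (M j j l + M j l j + M l j j) - 2 * r * ∑ j, s3 j * M j j j|
      ≤ 6 * c ^ 2 * m * N + 4 * m * c ^ 2 * ∑ j, |M j j j| := by
  have key : ∀ P : Fin m → Fin m → ℝ, (∑ j, ∑ l, P j l ^ 2 ≤ ∑ j, ∑ l, ∑ h, M j l h ^ 2) →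
      |∑ j, ∑ l, s2 j * s1 l * P j l| ≤ c ^ 2 * m * N := by
    intro P hP
    have := abs_sum_le_mul_sqrt_card_mul_sqrt (fun z : Fin m × Fin m => s2 z.1 * s1 z.2)
      (fun z => P z.1 z.2) (c := c ^ 2) (fun z => by
        rw [abs_mul, sq]
        exact mul_le_mul (h2 _) (h1 _) (abs_nonneg _) hc)
    simp only [Fintype.sum_prod_type, Fintype.card_prod, Fintype.card_fin, Nat.cast_mul] at this
    rw [Real.sqrt_mul_self (by positivity)] at this
    refine this.trans ?_
    rw [mul_assoc]
    gcongr
    exact (Real.sqrt_le_sqrt hP).trans hN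
  have k1 := key (fun j l => M j j l) <| by
    refine Finset.sum_le_sum fun j _ => ?_
    exact Finset.single_le_sum (f := fun l => ∑ h, M j l h ^ 2)
      (fun _ _ => Finset.sum_nonneg fun _ _ => sq_nonneg _) (Finset.mem_univ j)
  have k2 := key (fun j l => M j l j) <| by
    refine Finset.sum_le_sum fun j _ => Finset.sum_le_sum fun l _ => ?_
    exact Finset.single_le_sum (f := fun h => M j l h ^ 2)
      (fun _ _ => sq_nonneg _) (Finset.mem_univ j)
  have k3 := key (fun j l => M l j j) <| by
    rw [Finset.sum_comm]
    refine Finset.sum_le_sum fun j _ => Finset.sum_le_sum fun l _ => ?_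
    exact Finset.single_le_sum (f := fun h => M j l h ^ 2)
      (fun _ _ => sq_nonneg _) (Finset.mem_univ l)
  have k4 : |2 * r * ∑ j, s3 j * M j j j| ≤ 4 * m * c ^ 2 * ∑ j, |M j j j| := by
    have : |∑ j, s3 j * M j j j| ≤ c * ∑ j, |M j j j| := by
      rw [Finset.mul_sum]
      refine (Finset.abs_sum_le_sum_abs _ _).trans (Finset.sum_le_sum fun j _ => ?_)
      rw [abs_mul]
      gcongr
      exact h3 j
    rw [abs_mul, abs_mul, abs_two]
    calc 2 * |r| * |∑ j, s3 j * M j j j| ≤ 2 * (2 * m * c) * (c * ∑ j, |M j j j|) := by gcongr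
      _ = _ := by ring
  have e : ∑ j, ∑ l, 2 * (s2 j * s1 l) * (M j j l + M j l j + M l j j)
      = 2 * (∑ j, ∑ l, s2 j * s1 l * M j j l + ∑ j, ∑ l, s2 j * s1 l * M j l j
        + ∑ j, ∑ l, s2 j * s1 l * M l j j) := by
    simp only [Finset.mul_sum, ← Finset.sum_add_distrib]
    exact Finset.sum_congr rfl fun _ _ => Finset.sum_congr rfl fun _ _ => by ring
  rw [e]
  rw [abs_le] at *
  constructor <;> linarith [k1.1, k1.2, k2.1, k2.2, k3.1, k3.2, k4.1, k4.2]

/-- The pairing with `W` of the third derivative tensor of a squared loss, expressed through the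
compressions of `W` to the hidden units. -/
lemma sum_third_deriv_mul_eq {ι : Type*} [Fintype ι] {n m : ℕ} (L : Fin n → Fin m → ι → ℝ)
    (s1 s2 s3 : Fin n → Fin m → ℝ) (r : Fin n → ℝ) (W : ι → ι → ι → ℝ) :
    ∑ p, ∑ q, ∑ t, (∑ i, (∑ j, ∑ l, 2 * (s2 i j * s1 i l) * (L i j p * L i j q * L i l t
        + L i j p * L i l q * L i j t + L i l p * L i j q * L i j t)
        - 2 * r i * ∑ j, s3 i j * (L i j p * L i j q * L i j t))) * W p q t
      = ∑ i, (∑ j, ∑ l, 2 * (s2 i j * s1 i l) *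
        ((∑ p, L i j p * ∑ q, L i j q * ∑ t, L i l t * W p q t)
        + (∑ p, L i j p * ∑ q, L i l q * ∑ t, L i j t * W p q t)
        + (∑ p, L i l p * ∑ q, L i j q * ∑ t, L i j t * W p q t))
        - 2 * r i * ∑ j, s3 i j * ∑ p, L i j p * ∑ q, L i j q * ∑ t, L i j t * W p q t) := by
  have e : ∀ (i : Fin n) (j l h : Fin m),
      ∑ p, L i j p * ∑ q, L i l q * ∑ t, L i h t * W p q t
        = ∑ z : ι × ι × ι, L i j z.1 * L i l z.2.1 * L i h z.2.2 * W z.1 z.2.1 z.2.2 := by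
    intro i j l h
    simp only [Fintype.sum_prod_type, Finset.mul_sum, mul_assoc]
  simp only [e]
  have e' : ∀ f : ι → ι → ι → ℝ, ∑ p, ∑ q, ∑ t, f p q t
      = ∑ z : ι × ι × ι, f z.1 z.2.1 z.2.2 := by
    intro f
    simp only [Fintype.sum_prod_type]
  rw [e']
  simp only [Finset.sum_mul, ← Finset.sum_add_distrib]
  rw [Finset.sum_comm]
  refine Finset.sum_congr rfl fun i _ => ?_
  simp only [sub_mul, Finset.sum_sub_distrib, Finset.sum_mul, Finset.mul_sum]
  congr 1
  · rw [Finset.sum_comm]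
    refine Finset.sum_congr rfl fun j _ => ?_
    rw [Finset.sum_comm]
    refine Finset.sum_congr rfl fun l _ => Finset.sum_congr rfl fun z _ => ?_
    ring
  · rw [Finset.sum_comm]
    refine Finset.sum_congr rfl fun j _ => Finset.sum_congr rfl fun z _ => ?_
    ring

section Network

variable {E : Type*} [NormedAddCommGroup E] [NormedSpace ℝ E]

lemma hasFDerivAt_sum_activation {m : ℕ} (w : Fin m → ℝ) (ℓ : Fin m → E →L[ℝ] ℝ) {τ : ℝ → ℝ}
    (hτ : Differentiable ℝ τ) (a : Fin m → ℝ) (θ : E) :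
    HasFDerivAt (fun θ => ∑ j, w j * τ (ℓ j θ) * a j)
      (∑ j, (w j * deriv τ (ℓ j θ) * a j) • ℓ j) θ := by
  refine HasFDerivAt.fun_sum fun j _ => ?_
  have h := ((hτ (ℓ j θ)).hasDerivAt.comp_hasFDerivAt θ (ℓ j).hasFDerivAt).const_mul (w j)
    |>.mul_const (a j)
  refine h.congr_fderiv ?_
  ext v
  simp
  ring

lemma fderiv_squaredLoss_apply {n m : ℕ} (w : Fin m → ℝ) (ℓ : Fin n → Fin m → E →L[ℝ] ℝ)
    (y : Fin n → ℝ) {σ : ℝ → ℝ} (h0 : Differentiable ℝ σ) (θ v : E) :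
    fderiv ℝ (fun θ => ∑ i, (y i - ∑ j, w j * σ (ℓ i j θ)) ^ 2) θ v
      = ∑ i, -2 * (y i - ∑ j, w j * σ (ℓ i j θ)) * ∑ j, w j * deriv σ (ℓ i j θ) * ℓ i j v := by
  have h (i : Fin n) : HasFDerivAt (fun θ => (y i - ∑ j, w j * σ (ℓ i j θ)) ^ 2) _ θ :=
    ((by simpa using hasFDerivAt_sum_activation w (ℓ i) h0 1 θ :
      HasFDerivAt (fun θ => ∑ j, w j * σ (ℓ i j θ))
        (∑ j, (w j * deriv σ (ℓ i j θ)) • ℓ i j) θ).const_sub (y i)).pow 2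
  rw [(HasFDerivAt.fun_sum fun i _ => h i).fderiv]
  simp [mul_assoc]

lemma fderiv_fderiv_squaredLoss_apply {n m : ℕ} (w : Fin m → ℝ)
    (ℓ : Fin n → Fin m → E →L[ℝ] ℝ)
    (y : Fin n → ℝ) {σ : ℝ → ℝ} (h0 : Differentiable ℝ σ) (h1 : Differentiable ℝ (deriv σ))
    (θ u v : E) :
    fderiv ℝ (fun θ => fderiv ℝ (fun θ => ∑ i, (y i - ∑ j, w j * σ (ℓ i j θ)) ^ 2) θ v) θ u
      = ∑ i, (2 * (∑ j, w j * deriv σ (ℓ i j θ) * ℓ i j u)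
            * (∑ j, w j * deriv σ (ℓ i j θ) * ℓ i j v)
          - 2 * (y i - ∑ j, w j * σ (ℓ i j θ))
            * ∑ j, w j * deriv (deriv σ) (ℓ i j θ) * (ℓ i j u * ℓ i j v)) := by
  simp only [fderiv_squaredLoss_apply w ℓ y h0]
  have h (i : Fin n) : HasFDerivAt (fun θ => -2 * (y i - ∑ j, w j * σ (ℓ i j θ)) *
      ∑ j, w j * deriv σ (ℓ i j θ) * ℓ i j v) _ θ :=
    (((by simpa using hasFDerivAt_sum_activation w (ℓ i) h0 1 θ :
      HasFDerivAt (fun θ => ∑ j, w j * σ (ℓ i j θ))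
        (∑ j, (w j * deriv σ (ℓ i j θ)) • ℓ i j) θ).const_sub (y i)).const_mul (-2)).mul
      (hasFDerivAt_sum_activation w (ℓ i) h1 (fun j => ℓ i j v) θ)
  rw [(HasFDerivAt.fun_sum fun i _ => h i).fderiv, _root_.sum_apply]
  refine Finset.sum_congr rfl fun i _ => ?_
  have e : ∑ j, w j * deriv (deriv σ) (ℓ i j θ) * (ℓ i j u * ℓ i j v)
      = ∑ j, w j * deriv (deriv σ) (ℓ i j θ) * ℓ i j v * ℓ i j u :=
    Finset.sum_congr rfl fun _ _ => by ring
  rw [e]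
  simp
  ring

lemma fderiv_fderiv_fderiv_squaredLoss_apply {n m : ℕ} (w : Fin m → ℝ)
    (ℓ : Fin n → Fin m → E →L[ℝ] ℝ)
    (y : Fin n → ℝ) {σ : ℝ → ℝ} (h0 : Differentiable ℝ σ) (h1 : Differentiable ℝ (deriv σ))
    (h2 : Differentiable ℝ (deriv (deriv σ))) (θ t u v : E) :
    fderiv ℝ (fun θ => fderiv ℝ (fun θ =>
        fderiv ℝ (fun θ => ∑ i, (y i - ∑ j, w j * σ (ℓ i j θ)) ^ 2) θ v) θ u) θ t
      = ∑ i, (∑ j, ∑ l, 2 * ((w j * deriv (deriv σ) (ℓ i j θ)) * (w l * deriv σ (ℓ i l θ))) *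
            (ℓ i j t * ℓ i j u * ℓ i l v + ℓ i j t * ℓ i l u * ℓ i j v
              + ℓ i l t * ℓ i j u * ℓ i j v)
          - 2 * (y i - ∑ j, w j * σ (ℓ i j θ))
            * ∑ j, (w j * deriv (deriv (deriv σ)) (ℓ i j θ)) * (ℓ i j t * ℓ i j u * ℓ i j v)) := by
  simp only [fderiv_fderiv_squaredLoss_apply w ℓ y h0 h1]
  have h (i : Fin n) := (((hasFDerivAt_sum_activation w (ℓ i) h1 (fun j => ℓ i j u) θ).const_mul
      2).mul (hasFDerivAt_sum_activation w (ℓ i) h1 (fun j => ℓ i j v) θ)).sub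
    ((((by simpa using hasFDerivAt_sum_activation w (ℓ i) h0 1 θ :
      HasFDerivAt (fun θ => ∑ j, w j * σ (ℓ i j θ))
        (∑ j, (w j * deriv σ (ℓ i j θ)) • ℓ i j) θ).const_sub (y i)).const_mul 2).mul
      (hasFDerivAt_sum_activation w (ℓ i) h2 (fun j => ℓ i j u * ℓ i j v) θ))
  have h' := (HasFDerivAt.fun_sum (u := Finset.univ) fun i _ => h i).fderiv
  refine (congrArg (fun T => T t) h').trans ?_
  rw [_root_.sum_apply]
  refine Finset.sum_congr rfl fun i _ => ?_
  have e : ∑ j, ∑ l, 2 * ((w j * deriv (deriv σ) (ℓ i j θ)) * (w l * deriv σ (ℓ i l θ))) *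
            (ℓ i j t * ℓ i j u * ℓ i l v + ℓ i j t * ℓ i l u * ℓ i j v
              + ℓ i l t * ℓ i j u * ℓ i j v)
      = 2 * ((∑ j, w j * deriv (deriv σ) (ℓ i j θ) * ℓ i j u * ℓ i j t)
          * (∑ l, w l * deriv σ (ℓ i l θ) * ℓ i l v)
        + (∑ j, w j * deriv (deriv σ) (ℓ i j θ) * ℓ i j v * ℓ i j t)
          * (∑ l, w l * deriv σ (ℓ i l θ) * ℓ i l u)
        + (∑ j, w j * deriv (deriv σ) (ℓ i j θ) * (ℓ i j u * ℓ i j v))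
          * (∑ l, w l * deriv σ (ℓ i l θ) * ℓ i l t)) := by
    simp only [Finset.sum_mul_sum, ← Finset.sum_add_distrib]
    simp only [Finset.mul_sum]
    exact Finset.sum_congr rfl fun _ _ => Finset.sum_congr rfl fun _ _ => by ring
  have e2 : ∑ j, (w j * deriv (deriv (deriv σ)) (ℓ i j θ)) * (ℓ i j t * ℓ i j u * ℓ i j v)
      = ∑ j, w j * deriv (deriv (deriv σ)) (ℓ i j θ) * (ℓ i j u * ℓ i j v) * ℓ i j t :=
    Finset.sum_congr rfl fun _ _ => by ring
  rw [e, e2]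
  simp
  ring

lemma iteratedFDeriv_three_apply {f : E → ℝ} (hf : ContDiff ℝ 3 f) (θ t u v : E) :
    iteratedFDeriv ℝ 3 f θ ![t, u, v]
      = fderiv ℝ (fun θ => fderiv ℝ (fun θ => fderiv ℝ f θ v) θ u) θ t := by
  have hd : Differentiable ℝ (iteratedFDeriv ℝ 2 f) :=
    hf.differentiable_iteratedFDeriv (by norm_cast)
  have h1 : Differentiable ℝ (fderiv ℝ f) :=
    (hf.fderiv_right (m := 2) (by norm_num)).differentiable (by norm_num)
  rw [iteratedFDeriv_succ_apply_left, ← fderiv_continuousMultilinear_apply_const_apply (hd θ)]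
  have : (fun z => iteratedFDeriv ℝ 2 f z (Fin.tail ![t, u, v]))
      = fun θ => fderiv ℝ (fun θ => fderiv ℝ f θ v) θ u := by
    funext z
    rw [iteratedFDeriv_two_apply, fderiv_clm_apply (h1 z) (by fun_prop)]
    simp [Fin.tail]
  rw [this]
  simp

end Network

/-- Applying a contraction along both axes of a matrix does not increase its Frobenius norm. -/
lemma sum_contract_matrix_sq_le {ι κ : Type*} [Fintype ι] [Fintype κ] (L : κ → ι → ℝ)
    (hL : ∀ v : ι → ℝ, ∑ j, (∑ p, L j p * v p) ^ 2 ≤ ∑ p, v p ^ 2) (X : ι → ι → ℝ) :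
    ∑ j, ∑ l, (∑ p, L j p * ∑ q, L l q * X p q) ^ 2 ≤ ∑ p, ∑ q, X p q ^ 2 := by
  calc _ = ∑ l, ∑ j, (∑ p, L j p * ∑ q, L l q * X p q) ^ 2 := Finset.sum_comm
    _ ≤ ∑ l, ∑ p, (∑ q, L l q * X p q) ^ 2 := by
        gcongr with l _
        exact hL _
    _ = ∑ p, ∑ l, (∑ q, L l q * X p q) ^ 2 := Finset.sum_comm
    _ ≤ _ := by
        gcongr with p _
        exact hL _

lemma sum_diag_sq_le {κ : Type*} [Fintype κ] (D : κ → κ → ℝ) :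
    ∑ j, D j j ^ 2 ≤ ∑ j, ∑ l, D j l ^ 2 :=
  Finset.sum_le_sum fun j _ => Finset.single_le_sum (f := fun l => D j l ^ 2)
    (fun _ _ => sq_nonneg _) (Finset.mem_univ j)

lemma sum_diag_diag_sq_le {κ : Type*} [Fintype κ] (M : κ → κ → κ → ℝ) :
    ∑ j, M j j j ^ 2 ≤ ∑ j, ∑ l, ∑ h, M j l h ^ 2 :=
  (sum_diag_sq_le fun j h => M j j h).trans <| Finset.sum_le_sum fun j _ =>
    Finset.single_le_sum (f := fun l => ∑ h, M j l h ^ 2)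
      (fun _ _ => Finset.sum_nonneg fun _ _ => sq_nonneg _) (Finset.mem_univ j)

lemma norm123_third_deriv_le {ι : Type*} [Fintype ι] {n m : ℕ} (L : Fin n → Fin m → ι → ℝ)
    (hL : ∀ i (v : ι → ℝ), ∑ j, (∑ p, L i j p * v p) ^ 2 ≤ ∑ p, v p ^ 2)
    (s1 s2 s3 : Fin n → Fin m → ℝ) (r : Fin n → ℝ) {c : ℝ} (hc : 0 ≤ c)
    (h1 : ∀ i j, |s1 i j| ≤ c) (h2 : ∀ i j, |s2 i j| ≤ c) (h3 : ∀ i j, |s3 i j| ≤ c)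
    (hr : ∀ i, |r i| ≤ 2 * m * c) :
    norm123 (fun p q t => ∑ i, (∑ j, ∑ l, 2 * (s2 i j * s1 i l) * (L i j p * L i j q * L i l t
        + L i j p * L i l q * L i j t + L i l p * L i j q * L i j t)
        - 2 * r i * ∑ j, s3 i j * (L i j p * L i j q * L i j t)))
      ≤ 10 * (m * √m) * n * c ^ 2 := by
  set A : ι → ι → ι → ℝ := fun p q t =>
    ∑ i, (∑ j, ∑ l, 2 * (s2 i j * s1 i l) * (L i j p * L i j q * L i l t
        + L i j p * L i l q * L i j t + L i l p * L i j q * L i j t)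
        - 2 * r i * ∑ j, s3 i j * (L i j p * L i j q * L i j t))
  have e : ∀ W : ι → ι → ι → ℝ, ∑ p, ∑ q, ∑ t, A p q t * W p q t = _ :=
    sum_third_deriv_mul_eq L s1 s2 s3 r
  clear_value A
  set S := √(∑ p, ∑ q, ∑ t, A p q t ^ 2) with hS
  have hS0 : 0 ≤ S := Real.sqrt_nonneg _
  have hSS : S * S = ∑ p, ∑ q, ∑ t, A p q t * A p q t := by
    rw [hS, Real.mul_self_sqrt (by positivity)]
    simp only [sq]
  have hm : (m : ℝ) ≤ m * √m := by
    rcases Nat.eq_zero_or_pos m with h | h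
    · simp [h]
    · have : (1 : ℝ) ≤ √m := Real.one_le_sqrt.mpr (by exact_mod_cast h)
      nlinarith [(Nat.cast_nonneg m : (0 : ℝ) ≤ m)]
  have key : S * S ≤ (10 * (m * √m) * n * c ^ 2) * S := by
    rw [hSS]
    refine (le_abs_self _).trans ?_
    rw [e]
    refine (Finset.abs_sum_le_sum_abs _ _).trans ((Finset.sum_le_sum
      (g := fun _ => 10 * (m * √m) * c ^ 2 * S) fun i _ => ?_).trans (le_of_eq ?_))
    · have hN := Real.sqrt_le_sqrt (sum_contract_sq_le (L i) (hL i) A)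
      refine (abs_third_deriv_pairing_le
        (fun j l h => ∑ p, L i j p * ∑ q, L i l q * ∑ t, L i h t * A p q t)
        (s1 i) (s2 i) (s3 i) hc (h1 i) (h2 i) (h3 i) (hr i) hN).trans ?_
      have hd : ∑ j, |∑ p, L i j p * ∑ q, L i j q * ∑ t, L i j t * A p q t| ≤ √m * S := by
        have := abs_sum_le_mul_sqrt_card_mul_sqrt (fun _ : Fin m => (1 : ℝ))
          (fun j => |∑ p, L i j p * ∑ q, L i j q * ∑ t, L i j t * A p q t|) (c := 1) (by simp)
        simp only [one_mul, sq_abs, Fintype.card_fin] at this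
        refine (le_abs_self _).trans (this.trans ?_)
        gcongr
        exact (Real.sqrt_le_sqrt (sum_diag_diag_sq_le
          fun j l h => ∑ p, L i j p * ∑ q, L i l q * ∑ t, L i h t * A p q t)).trans hN
      calc _ ≤ 6 * c ^ 2 * (m * √m) * S + 4 * m * c ^ 2 * (√m * S) := by gcongr
        _ = _ := by ring
    · simp
      ring
  change S ≤ _
  rcases hS0.eq_or_lt with h | h
  · rw [← h]
    positivity
  · exact le_of_mul_le_mul_right key h

lemma norm12_3_third_deriv_le {ι : Type*} [Fintype ι] {n m : ℕ} (L : Fin n → Fin m → ι → ℝ)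
    {β : ℝ} (hL : ∀ i (v : ι → ℝ), ∑ j, (∑ p, L i j p * v p) ^ 2 ≤ ∑ p, v p ^ 2)
    (hβ : 0 ≤ β) (hLβ : ∀ v : ι → ℝ, ∑ i, ∑ j, (∑ p, L i j p * v p) ^ 2 ≤ β * ∑ p, v p ^ 2)
    (s1 s2 s3 : Fin n → Fin m → ℝ) (r : Fin n → ℝ) {c : ℝ} (hc : 0 ≤ c)
    (h1 : ∀ i j, |s1 i j| ≤ c) (h2 : ∀ i j, |s2 i j| ≤ c) (h3 : ∀ i j, |s3 i j| ≤ c)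
    (hr : ∀ i, |r i| ≤ 2 * m * c) :
    norm12_3 (fun p q t => ∑ i, (∑ j, ∑ l, 2 * (s2 i j * s1 i l) * (L i j p * L i j q * L i l t
        + L i j p * L i l q * L i j t + L i l p * L i j q * L i j t)
        - 2 * r i * ∑ j, s3 i j * (L i j p * L i j q * L i j t)))
      ≤ 10 * (m * √n * √β) * c ^ 2 := by
  refine Real.sSup_le ?_ (by positivity)
  rintro _ ⟨X, y, hX, hy, rfl⟩
  simp only [mul_assoc _ (X _ _) (y _)]
  rw [sum_third_deriv_mul_eq L s1 s2 s3 r (fun p q t => X p q * y t)]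
  set D : Fin n → Fin m → Fin m → ℝ := fun i j l => ∑ p, L i j p * ∑ q, L i l q * X p q with hD
  set Y : Fin n → Fin m → ℝ := fun i h => ∑ t, L i h t * y t with hY
  have hM : ∀ i j l h, ∑ p, L i j p * ∑ q, L i l q * ∑ t, L i h t * (X p q * y t)
      = D i j l * Y i h := by
    intro i j l h
    have : ∀ p q, ∑ t, L i h t * (X p q * y t) = X p q * Y i h := by
      intro p q
      rw [Finset.mul_sum]
      exact Finset.sum_congr rfl fun _ _ => by ring
    simp only [this, hD, Finset.sum_mul, mul_assoc]
  simp only [hM]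
  have hD1 : ∀ i, ∑ j, ∑ l, D i j l ^ 2 ≤ 1 := fun i =>
    (sum_contract_matrix_sq_le (L i) (hL i) X).trans hX
  refine (le_abs_self _).trans ((Finset.abs_sum_le_sum_abs _ _).trans ((Finset.sum_le_sum
    (g := fun i => 10 * c ^ 2 * m * √(∑ h, Y i h ^ 2)) fun i _ => ?_).trans ?_))
  · have hN : √(∑ j, ∑ l, ∑ h, (D i j l * Y i h) ^ 2) ≤ √(∑ h, Y i h ^ 2) := by
      apply Real.sqrt_le_sqrt
      simp only [mul_pow, ← Finset.mul_sum, ← Finset.sum_mul]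
      exact mul_le_of_le_one_left (Finset.sum_nonneg fun _ _ => sq_nonneg _) (hD1 i)
    refine (abs_third_deriv_pairing_le (fun j l h => D i j l * Y i h)
      (s1 i) (s2 i) (s3 i) hc (h1 i) (h2 i) (h3 i) (hr i) hN).trans ?_
    have hd : ∑ j, |D i j j * Y i j| ≤ √(∑ h, Y i h ^ 2) := by
      simp only [abs_mul]
      refine (Real.sum_mul_le_sqrt_mul_sqrt _ _ _).trans ?_
      simp only [sq_abs]
      refine mul_le_of_le_one_left (Real.sqrt_nonneg _) ?_
      exact Real.sqrt_le_one.mpr ((sum_diag_sq_le (D i)).trans (hD1 i))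
    calc _ ≤ 6 * c ^ 2 * m * √(∑ h, Y i h ^ 2) + 4 * m * c ^ 2 * √(∑ h, Y i h ^ 2) := by gcongr
      _ = _ := by ring
  rw [← Finset.mul_sum]
  have hYs : ∑ i, √(∑ h, Y i h ^ 2) ≤ √n * √β := by
    have := abs_sum_le_mul_sqrt_card_mul_sqrt (fun _ : Fin n => (1 : ℝ))
      (fun i => √(∑ h, Y i h ^ 2)) (c := 1) (by simp)
    simp only [one_mul, Fintype.card_fin] at this
    refine (le_abs_self _).trans (this.trans ?_)
    gcongr
    refine le_trans (le_of_eq ?_) ((hLβ y).trans (mul_le_of_le_one_right hβ hy))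
    exact Finset.sum_congr rfl fun i _ =>
      Real.sq_sqrt (Finset.sum_nonneg fun _ _ => sq_nonneg _)
  calc _ ≤ 10 * c ^ 2 * m * (√n * √β) := by gcongr
    _ = _ := by ring

/-- Bound on the bilinear form of the Hessian of a squared loss. -/
lemma abs_second_deriv_pairing_le {n m : ℕ} (U V : Fin n → Fin m → ℝ) {a b : ℝ}
    (ha : 0 ≤ a) (hb : 0 ≤ b)
    (hU : ∀ i, ∑ j, U i j ^ 2 ≤ a ^ 2) (hV : ∀ i, ∑ j, V i j ^ 2 ≤ b ^ 2)
    (s1 s2 : Fin n → Fin m → ℝ) (r : Fin n → ℝ) {c : ℝ} (hc : 0 ≤ c)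
    (h1 : ∀ i j, |s1 i j| ≤ c) (h2 : ∀ i j, |s2 i j| ≤ c) (hr : ∀ i, |r i| ≤ 2 * m * c) :
    |∑ i, (2 * (∑ j, s1 i j * U i j) * (∑ j, s1 i j * V i j)
      - 2 * r i * ∑ j, s2 i j * (U i j * V i j))| ≤ 6 * m * n * c ^ 2 * a * b := by
  refine (Finset.abs_sum_le_sum_abs _ _).trans ((Finset.sum_le_sum
    (g := fun _ => 6 * m * c ^ 2 * a * b) fun i _ => ?_).trans (le_of_eq ?_))
  · refine (abs_sub _ _).trans ?_
    have hUa : √(∑ j, U i j ^ 2) ≤ a := Real.sqrt_le_iff.mpr ⟨ha, hU i⟩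
    have hVb : √(∑ j, V i j ^ 2) ≤ b := Real.sqrt_le_iff.mpr ⟨hb, hV i⟩
    have k1 : |∑ j, s1 i j * U i j| ≤ c * (√m * a) := by
      refine (abs_sum_le_mul_sqrt_card_mul_sqrt _ _ (h1 i)).trans ?_
      rw [Fintype.card_fin]
      gcongr
    have k2 : |∑ j, s1 i j * V i j| ≤ c * (√m * b) := by
      refine (abs_sum_le_mul_sqrt_card_mul_sqrt _ _ (h1 i)).trans ?_
      rw [Fintype.card_fin]
      gcongr
    have k3 : |∑ j, s2 i j * (U i j * V i j)| ≤ c * (a * b) := by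
      calc _ ≤ ∑ j, c * (|U i j| * |V i j|) := by
            refine (Finset.abs_sum_le_sum_abs _ _).trans (Finset.sum_le_sum fun j _ => ?_)
            rw [abs_mul, abs_mul]
            gcongr
            exact h2 i j
        _ ≤ c * (√(∑ j, U i j ^ 2) * √(∑ j, V i j ^ 2)) := by
            rw [← Finset.mul_sum]
            gcongr
            simpa only [sq_abs] using
              Real.sum_mul_le_sqrt_mul_sqrt Finset.univ (fun j => |U i j|) (fun j => |V i j|)
        _ ≤ _ := by gcongr
    simp only [abs_mul, abs_two]
    calc _ ≤ 2 * (c * (√m * a)) * (c * (√m * b)) + 2 * (2 * m * c) * (c * (a * b)) := by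
          gcongr
          exact hr i
      _ = 2 * c ^ 2 * a * b * (√m * √m) + 4 * m * c ^ 2 * a * b := by ring
      _ = _ := by
          rw [Real.mul_self_sqrt (Nat.cast_nonneg m)]
          ring
  · simp
    ring

lemma norm_fderiv_gradient_le {E : Type*} [NormedAddCommGroup E] [InnerProductSpace ℝ E]
    [CompleteSpace E] {f : E → ℝ} (hf : ContDiff ℝ 2 f) (θ : E) {B : ℝ} (hB : 0 ≤ B)
    (h : ∀ u v, |fderiv ℝ (fun θ => fderiv ℝ f θ v) θ u| ≤ B * ‖u‖ * ‖v‖) :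
    ‖fderiv ℝ (gradient f) θ‖ ≤ B := by
  have h1 : Differentiable ℝ (fderiv ℝ f) :=
    (hf.fderiv_right (m := 1) (by norm_num)).differentiable (by norm_num)
  have hg : Differentiable ℝ (gradient f) :=
    (InnerProductSpace.toDual ℝ E).symm.toContinuousLinearEquiv.differentiable.comp h1
  refine ContinuousLinearMap.opNorm_le_bound _ hB fun u => ?_
  set z := fderiv ℝ (gradient f) θ u with hz
  have e : fderiv ℝ (fun θ => fderiv ℝ f θ z) θ u = inner ℝ z z := by
    have : (fun θ => fderiv ℝ f θ z) = fun θ => inner ℝ (gradient f θ) z := by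
      funext θ
      exact inner_gradient_left.symm
    rw [this, fderiv_inner_apply ℝ (hg θ) (differentiableAt_const z)]
    simp [hz]
  have hzz := (le_abs_self _).trans (h u z)
  rw [e, real_inner_self_eq_norm_mul_norm] at hzz
  rcases (norm_nonneg z).eq_or_lt with h0 | h0
  · rw [← h0]
    positivity
  · exact le_of_mul_le_mul_right hzz h0

/-- If the Gram operator `Σ_i x_i x_iᵀ` has norm at most `β`, then `Σ_i ⟨x_i, z⟩² ≤ β ‖z‖²`. -/
lemma sum_sq_le_of_gram_norm_le {d n : ℕ} (x : Fin n → EuclideanSpace ℝ (Fin d)) {β : ℝ}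
    (h : ‖LinearMap.toContinuousLinearMap (Matrix.toEuclideanLin
      (Matrix.of fun k k' : Fin d => ∑ i, x i k * x i k'))‖ ≤ β) (z : Fin d → ℝ) :
    ∑ i, (∑ k, x i k * z k) ^ 2 ≤ β * ∑ k, z k ^ 2 := by
  set T := LinearMap.toContinuousLinearMap (Matrix.toEuclideanLin
      (Matrix.of fun k k' : Fin d => ∑ i, x i k * x i k')) with hT
  set Z : EuclideanSpace ℝ (Fin d) := WithLp.toLp 2 z with hZ
  have e : inner ℝ (T Z) Z = ∑ i, (∑ k, x i k * z k) ^ 2 := by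
    have hTZ : inner ℝ (T Z) Z = ∑ k, z k * ∑ k', (∑ i, x i k * x i k') * z k' := by
      simp [hT, hZ, PiLp.inner_apply, Matrix.toLpLin_apply, Matrix.mulVec, dotProduct]
    simp only [hTZ, sq, Finset.sum_mul_sum]
    simp only [Finset.sum_mul, Finset.mul_sum]
    rw [Finset.sum_congr rfl fun _ _ => Finset.sum_comm, Finset.sum_comm]
    refine Finset.sum_congr rfl fun i _ => Finset.sum_congr rfl fun k _ =>
      Finset.sum_congr rfl fun k' _ => by ring
  have hn : ‖Z‖ * ‖Z‖ = ∑ k, z k ^ 2 := by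
    rw [← sq, EuclideanSpace.real_norm_sq_eq]
  rw [← e, ← hn]
  calc _ ≤ ‖T Z‖ * ‖Z‖ := real_inner_le_norm _ _
    _ ≤ (‖T‖ * ‖Z‖) * ‖Z‖ := by gcongr; exact T.le_opNorm Z
    _ ≤ β * (‖Z‖ * ‖Z‖) := by rw [mul_assoc]; gcongr

/-- The map `θ ↦ ⟨θ_j, x_i⟩` giving the input of hidden unit `j` on data point `i`. -/
noncomputable def hiddenPreactivation {m d n : ℕ} (x : Fin n → EuclideanSpace ℝ (Fin d)) (i : Fin n)
    (j : Fin m) : EuclideanSpace ℝ (Fin m × Fin d) →L[ℝ] ℝ :=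
  ∑ k, x i k • EuclideanSpace.proj (j, k)

lemma hiddenPreactivation_apply {m d n : ℕ} (x : Fin n → EuclideanSpace ℝ (Fin d)) (i : Fin n)
    (j : Fin m) (θ : EuclideanSpace ℝ (Fin m × Fin d)) :
    hiddenPreactivation x i j θ = ∑ k, θ (j, k) * x i k := by
  simp [hiddenPreactivation, mul_comm]

lemma sum_hiddenPreactivation_single_mul {m d n : ℕ} (x : Fin n → EuclideanSpace ℝ (Fin d))
    (i : Fin n) (j : Fin m) (v : Fin m × Fin d → ℝ) :
    ∑ p, hiddenPreactivation x i j (EuclideanSpace.single p 1) * v p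
      = ∑ k, x i k * v (j, k) := by
  have h : ∀ (j' : Fin m) (k' : Fin d),
      hiddenPreactivation x i j (EuclideanSpace.single (j', k') 1)
        = if j' = j then x i k' else 0 := by
    intro j' k'
    simp only [hiddenPreactivation_apply, PiLp.single_apply, Prod.mk.injEq]
    by_cases hj : j' = j
    · simp [hj]
    · simp [hj, Ne.symm hj]
  simp [Fintype.sum_prod_type, h]

lemma sum_hiddenPreactivation_sq_le {m d n : ℕ} (x : Fin n → EuclideanSpace ℝ (Fin d))
    (hx : ∀ i, ‖x i‖ ≤ 1) (i : Fin n) (v : Fin m × Fin d → ℝ) :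
    ∑ j, (∑ k, x i k * v (j, k)) ^ 2 ≤ ∑ p, v p ^ 2 := by
  rw [Fintype.sum_prod_type]
  refine Finset.sum_le_sum fun j _ => (Finset.sum_mul_sq_le_sq_mul_sq _ _ _).trans ?_
  rw [← EuclideanSpace.real_norm_sq_eq]
  exact mul_le_of_le_one_left (Finset.sum_nonneg fun _ _ => sq_nonneg _)
    (pow_le_one₀ (norm_nonneg _) (hx i))

/-- **Lemma (derivative tensor bounds for two-layer neural network losses).** -/
theorem two_layer_network_derivative_bounds :
    ∃ C : ℝ, 0 < C ∧
    ∀ (m d' n : ℕ) (σ : ℝ → ℝ) (w : Fin m → ℝ)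
      (x : Fin n → EuclideanSpace ℝ (Fin d')) (y : Fin n → ℝ) (c β : ℝ),
      ContDiff ℝ 3 σ →
      (∀ z, |σ z| ≤ c) → (∀ z, |deriv σ z| ≤ c) →
      (∀ z, |deriv (deriv σ) z| ≤ c) → (∀ z, |deriv (deriv (deriv σ)) z| ≤ c) →
      (∀ j, |w j| ≤ 1) → (∀ i, ‖x i‖ = 1) → (∀ i, |y i| ≤ (m : ℝ) * c) →
      ‖LinearMap.toContinuousLinearMap (Matrix.toEuclideanLin
          (Matrix.of fun k k' : Fin d' => ∑ i, x i k * x i k'))‖ ≤ β →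
      let 𝓛 : EuclideanSpace ℝ (Fin m × Fin d') → ℝ :=
        fun θ => ∑ i, (y i - ∑ j, w j * σ (∑ k, θ (j, k) * x i k))^2
      ∀ θ : EuclideanSpace ℝ (Fin m × Fin d'),
        ‖fderiv ℝ (gradient 𝓛) θ‖ ≤ C * (m : ℝ) * (n : ℝ) * c^2 ∧
        norm123 (tensor3 𝓛 θ) ≤ C * (m : ℝ) ^ ((3:ℝ)/2) * (n : ℝ) * c^2 ∧
        norm12_3 (tensor3 𝓛 θ)
          ≤ C * ((m : ℝ) * (n : ℝ) ^ ((1:ℝ)/2) * (1 + β ^ ((1:ℝ)/2))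
              + (n : ℝ) * (m : ℝ) ^ ((1:ℝ)/2)) * c^2 := by
  refine ⟨10, by norm_num, ?_⟩
  intro m d' n σ w x y c β hσ h0 h1 h2 h3 hw hx hy hβ 𝓛 θ
  have hc : 0 ≤ c := (abs_nonneg _).trans (h0 0)
  have hβ0 : 0 ≤ β := (norm_nonneg _).trans hβ
  have hσ1 : ContDiff ℝ 2 (deriv σ) := (contDiff_succ_iff_deriv.mp hσ).2.2
  have hσ2 : ContDiff ℝ 1 (deriv (deriv σ)) := (contDiff_succ_iff_deriv.mp hσ1).2.2
  have d0 : Differentiable ℝ σ := hσ.differentiable (by norm_num)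
  have d1 : Differentiable ℝ (deriv σ) := hσ1.differentiable (by norm_num)
  have d2 : Differentiable ℝ (deriv (deriv σ)) := hσ2.differentiable (by norm_num)
  set ℓ : Fin n → Fin m → EuclideanSpace ℝ (Fin m × Fin d') →L[ℝ] ℝ :=
    hiddenPreactivation x with hℓ
  have h𝓛 : 𝓛 = fun θ => ∑ i, (y i - ∑ j, w j * σ (ℓ i j θ)) ^ 2 := by
    funext θ
    simp only [𝓛, hℓ, hiddenPreactivation_apply]
  have hC : ContDiff ℝ 3 𝓛 := by
    rw [h𝓛]
    refine ContDiff.sum fun i _ => (contDiff_const.sub (ContDiff.sum fun j _ => ?_)).pow 2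
    exact contDiff_const.mul (hσ.comp (ℓ i j).contDiff)
  have hwτ : ∀ {τ : ℝ → ℝ}, (∀ z, |τ z| ≤ c) → ∀ i j, |w j * τ (ℓ i j θ)| ≤ c := by
    intro τ hτ i j
    rw [abs_mul]
    exact (mul_le_of_le_one_left (abs_nonneg _) (hw j)).trans (hτ _)
  have hr : ∀ i, |y i - ∑ j, w j * σ (ℓ i j θ)| ≤ 2 * m * c := by
    intro i
    have : |∑ j, w j * σ (ℓ i j θ)| ≤ m * c := by
      refine (Finset.abs_sum_le_sum_abs _ _).trans ?_
      simpa using Finset.sum_le_card_nsmul Finset.univ _ c fun j _ => hwτ h0 i j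
    linarith [abs_sub (y i) (∑ j, w j * σ (ℓ i j θ)), hy i]
  rw [h𝓛] at hC ⊢
  have hA := funext fun p => funext fun q => funext fun t =>
    (iteratedFDeriv_three_apply hC θ (EuclideanSpace.single p 1) (EuclideanSpace.single q 1)
      (EuclideanSpace.single t 1)).trans
      (fderiv_fderiv_fderiv_squaredLoss_apply w ℓ y d0 d1 d2 θ _ _ _)
  change tensor3 _ θ = _ at hA
  have hL : ∀ i (v : Fin m × Fin d' → ℝ),
      ∑ j, (∑ p, ℓ i j (EuclideanSpace.single p 1) * v p) ^ 2 ≤ ∑ p, v p ^ 2 := by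
    intro i v
    simp only [hℓ, sum_hiddenPreactivation_single_mul]
    exact sum_hiddenPreactivation_sq_le x (fun i => (hx i).le) i v
  have hLβ : ∀ v : Fin m × Fin d' → ℝ,
      ∑ i, ∑ j, (∑ p, ℓ i j (EuclideanSpace.single p 1) * v p) ^ 2 ≤ β * ∑ p, v p ^ 2 := by
    intro v
    simp only [hℓ, sum_hiddenPreactivation_single_mul]
    rw [Finset.sum_comm, Fintype.sum_prod_type, Finset.mul_sum]
    exact Finset.sum_le_sum fun j _ => sum_sq_le_of_gram_norm_le x hβ fun k => v (j, k)
  refine ⟨?_, ?_, ?_⟩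
  · refine (norm_fderiv_gradient_le (hC.of_le (by norm_num)) θ (B := 6 * m * n * c ^ 2)
      (by positivity) fun u v => ?_).trans (by gcongr; norm_num)
    rw [fderiv_fderiv_squaredLoss_apply w ℓ y d0 d1]
    have hU : ∀ (u : EuclideanSpace ℝ (Fin m × Fin d')) i, ∑ j, ℓ i j u ^ 2 ≤ ‖u‖ ^ 2 := by
      intro u i
      simp only [hℓ, hiddenPreactivation_apply, mul_comm (u _), EuclideanSpace.real_norm_sq_eq]
      exact sum_hiddenPreactivation_sq_le x (fun i => (hx i).le) i u
    exact abs_second_deriv_pairing_le _ _ (norm_nonneg u) (norm_nonneg v) (hU u) (hU v) _ _ _ hc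
      (hwτ h1) (hwτ h2) hr
  · rw [hA]
    refine (norm123_third_deriv_le (fun i j p => ℓ i j (EuclideanSpace.single p 1)) hL
      _ _ _ _ hc (hwτ h1) (hwτ h2) (hwτ h3) hr).trans (le_of_eq ?_)
    have : (m : ℝ) ^ ((3 : ℝ) / 2) = m * √m := by
      rw [show (3 : ℝ) / 2 = 1 + 1 / 2 by norm_num,
        Real.rpow_add_of_nonneg (Nat.cast_nonneg m) (by norm_num) (by norm_num), Real.rpow_one,
        Real.sqrt_eq_rpow]
    rw [this]
  · rw [hA]
    refine (norm12_3_third_deriv_le (fun i j p => ℓ i j (EuclideanSpace.single p 1)) hL hβ0 hLβ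
      _ _ _ _ hc (hwτ h1) (hwτ h2) (hwτ h3) hr).trans ?_
    simp only [← Real.sqrt_eq_rpow]
    have k1 : (0 : ℝ) ≤ m * √n := by positivity
    have k2 : (0 : ℝ) ≤ n * √m := by positivity
    gcongr
    nlinarith
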